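/- arXiv:1306.4829 — 2 statements merged into one kernel-verified Lean document; each statement's English description precedes it below -/
import Mathlib

section
/- Let (M,⊗,K,σ) be a braided monoidal category, regarded as a duoidal category with both monoidal products equal to ⊗, δ, ϖ, τ the identity coherences on K, and interchange ζ = A⊗σ_{B,C}⊗D. Let A carry a monoid structure (μ,η) and a comonoid structure (Δ,ε) satisfying Δ.μ = (μ⊗μ).(A⊗σ_{A,A}⊗A).(Δ⊗Δ). Then A is a weak bimonoid in the sense of Pastro–Street, i.e. it satisfies the weak unit axioms (Δ⊗A).Δ.η = (A⊗μ⊗A).(Δ.η⊗Δ.η) and (Δ⊗A).Δ.η = (A⊗(μ.σ⁻¹_{A,A})⊗A).(Δ.η⊗Δ.η) and the weak counit axioms ε.μ.(μ⊗A) = (ε.μ⊗ε.μ).(A⊗Δ⊗A) and ε.μ.(μ⊗A) = (ε.μ⊗ε.μ).(A⊗(σ⁻¹_{A,A}.Δ)⊗A), if and only if A is a right weak bimonoid in this duoidal category, i.e. it satisfies the axioms (RRU), (LRU), (LRC), (LLC). -/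
open CategoryTheory

universe v u

/-- A (strict) duoidal category structure on a category `M`: two strict monoidal
structures `co` (the first monoidal product `∘` with unit `uI`) and `bu` (the second
monoidal product `•` with unit `uJ`), together with the structure morphisms
`dlI : I ⟶ I • I`, `pw : J ∘ J ⟶ J`, `tau : I ⟶ J` and the interchange law `zt`,
subject to the axioms of a duoidal category. -/
structure Duo (M : Type u) [Category.{v} M] where
  co : M → M → M
  coh : ∀ {X₁ Y₁ X₂ Y₂ : M}, (X₁ ⟶ Y₁) → (X₂ ⟶ Y₂) → (co X₁ X₂ ⟶ co Y₁ Y₂)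
  uI : M
  bu : M → M → M
  buh : ∀ {X₁ Y₁ X₂ Y₂ : M}, (X₁ ⟶ Y₁) → (X₂ ⟶ Y₂) → (bu X₁ X₂ ⟶ bu Y₁ Y₂)
  uJ : M
  coA : ∀ X Y Z, co (co X Y) Z = co X (co Y Z)
  coL : ∀ X, co uI X = X
  coR : ∀ X, co X uI = X
  buA : ∀ X Y Z, bu (bu X Y) Z = bu X (bu Y Z)
  buL : ∀ X, bu uJ X = X
  buR : ∀ X, bu X uJ = X
  coh_id : ∀ X Y, coh (𝟙 X) (𝟙 Y) = 𝟙 (co X Y)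
  coh_comp : ∀ {X₁ Y₁ Z₁ X₂ Y₂ Z₂ : M} (f₁ : X₁ ⟶ Y₁) (g₁ : Y₁ ⟶ Z₁) (f₂ : X₂ ⟶ Y₂)
    (g₂ : Y₂ ⟶ Z₂), coh (f₁ ≫ g₁) (f₂ ≫ g₂) = coh f₁ f₂ ≫ coh g₁ g₂
  buh_id : ∀ X Y, buh (𝟙 X) (𝟙 Y) = 𝟙 (bu X Y)
  buh_comp : ∀ {X₁ Y₁ Z₁ X₂ Y₂ Z₂ : M} (f₁ : X₁ ⟶ Y₁) (g₁ : Y₁ ⟶ Z₁) (f₂ : X₂ ⟶ Y₂)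
    (g₂ : Y₂ ⟶ Z₂), buh (f₁ ≫ g₁) (f₂ ≫ g₂) = buh f₁ f₂ ≫ buh g₁ g₂
  coh_assoc : ∀ {X₁ Y₁ X₂ Y₂ X₃ Y₃ : M} (f₁ : X₁ ⟶ Y₁) (f₂ : X₂ ⟶ Y₂) (f₃ : X₃ ⟶ Y₃),
    coh (coh f₁ f₂) f₃
      = eqToHom (coA X₁ X₂ X₃) ≫ coh f₁ (coh f₂ f₃) ≫ eqToHom (coA Y₁ Y₂ Y₃).symm
  coh_unitL : ∀ {X Y : M} (f : X ⟶ Y),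
    coh (𝟙 uI) f = eqToHom (coL X) ≫ f ≫ eqToHom (coL Y).symm
  coh_unitR : ∀ {X Y : M} (f : X ⟶ Y),
    coh f (𝟙 uI) = eqToHom (coR X) ≫ f ≫ eqToHom (coR Y).symm
  buh_assoc : ∀ {X₁ Y₁ X₂ Y₂ X₃ Y₃ : M} (f₁ : X₁ ⟶ Y₁) (f₂ : X₂ ⟶ Y₂) (f₃ : X₃ ⟶ Y₃),
    buh (buh f₁ f₂) f₃
      = eqToHom (buA X₁ X₂ X₃) ≫ buh f₁ (buh f₂ f₃) ≫ eqToHom (buA Y₁ Y₂ Y₃).symm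
  buh_unitL : ∀ {X Y : M} (f : X ⟶ Y),
    buh (𝟙 uJ) f = eqToHom (buL X) ≫ f ≫ eqToHom (buL Y).symm
  buh_unitR : ∀ {X Y : M} (f : X ⟶ Y),
    buh f (𝟙 uJ) = eqToHom (buR X) ≫ f ≫ eqToHom (buR Y).symm
  dlI : uI ⟶ bu uI uI
  pw : co uJ uJ ⟶ uJ
  tau : uI ⟶ uJ
  zt : ∀ A B C D : M, co (bu A B) (bu C D) ⟶ bu (co A C) (co B D)
  zt_nat : ∀ {A A' B B' C C' D D' : M} (f : A ⟶ A') (g : B ⟶ B') (h : C ⟶ C')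
    (k : D ⟶ D'),
    coh (buh f g) (buh h k) ≫ zt A' B' C' D' = zt A B C D ≫ buh (coh f h) (coh g k)
  pw_assoc : coh pw (𝟙 uJ) ≫ pw = eqToHom (coA uJ uJ uJ) ≫ coh (𝟙 uJ) pw ≫ pw
  pw_unitL : eqToHom (coL uJ).symm ≫ coh tau (𝟙 uJ) ≫ pw = 𝟙 uJ
  pw_unitR : eqToHom (coR uJ).symm ≫ coh (𝟙 uJ) tau ≫ pw = 𝟙 uJ
  dlI_coassoc : dlI ≫ buh dlI (𝟙 uI) ≫ eqToHom (buA uI uI uI) = dlI ≫ buh (𝟙 uI) dlI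
  dlI_counitL : dlI ≫ buh tau (𝟙 uI) ≫ eqToHom (buL uI) = 𝟙 uI
  dlI_counitR : dlI ≫ buh (𝟙 uI) tau ≫ eqToHom (buR uI) = 𝟙 uI
  zt_assoc1 : ∀ A B C D E F : M,
    coh (zt A B C D) (𝟙 (bu E F)) ≫ zt (co A C) (co B D) E F
      = eqToHom (coA (bu A B) (bu C D) (bu E F)) ≫ coh (𝟙 (bu A B)) (zt C D E F)
          ≫ zt A B (co C E) (co D F)
          ≫ eqToHom (show bu (co A (co C E)) (co B (co D F))
              = bu (co (co A C) E) (co (co B D) F) by simp [coA])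
  zt_assoc2 : ∀ A B C D E F : M,
    zt (bu A B) C (bu D E) F ≫ buh (zt A B D E) (𝟙 (co C F))
      = eqToHom (show co (bu (bu A B) C) (bu (bu D E) F)
            = co (bu A (bu B C)) (bu D (bu E F)) by simp [buA])
          ≫ zt A (bu B C) D (bu E F) ≫ buh (𝟙 (co A D)) (zt B C E F)
          ≫ eqToHom (buA (co A D) (co B E) (co C F)).symm
  zt_unitA : ∀ A B : M,
    eqToHom (coL (bu A B)).symm ≫ coh dlI (𝟙 (bu A B)) ≫ zt uI uI A B
      ≫ eqToHom (show bu (co uI A) (co uI B) = bu A B by simp [coL]) = 𝟙 (bu A B)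
  zt_unitB : ∀ A B : M,
    eqToHom (coR (bu A B)).symm ≫ coh (𝟙 (bu A B)) dlI ≫ zt A B uI uI
      ≫ eqToHom (show bu (co A uI) (co B uI) = bu A B by simp [coR]) = 𝟙 (bu A B)
  zt_unitC : ∀ A B : M,
    eqToHom (show co A B = co (bu uJ A) (bu uJ B) by simp [buL]) ≫ zt uJ A uJ B
      ≫ buh pw (𝟙 (co A B)) ≫ eqToHom (buL (co A B)) = 𝟙 (co A B)
  zt_unitD : ∀ A B : M,
    eqToHom (show co A B = co (bu A uJ) (bu B uJ) by simp [buR]) ≫ zt A uJ B uJ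
      ≫ buh (𝟙 (co A B)) pw ≫ eqToHom (buR (co A B)) = 𝟙 (co A B)

namespace Duo

variable {M : Type u} [Category.{v} M] (D : Duo M)

/-- Axiom (WB): the multiplication is comultiplicative. -/
def WBeq (A : M) (mu : D.co A A ⟶ A) (dl : A ⟶ D.bu A A) : Prop :=
  mu ≫ dl = D.coh dl dl ≫ D.zt A A A A ≫ D.buh mu mu

/-- Axiom (RRU). -/
def RRUeq (A : M) (mu : D.co A A ⟶ A) (eta : D.uI ⟶ A) (dl : A ⟶ D.bu A A) : Prop :=
  D.dlI ≫ D.buh (𝟙 D.uI) (eta ≫ dl)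
    ≫ eqToHom (show D.bu D.uI (D.bu A A) = D.bu (D.co (D.bu D.uI A) D.uI) A by
        simp [D.coR, D.buA])
    ≫ D.buh (D.coh (𝟙 (D.bu D.uI A)) D.dlI) (𝟙 A)
    ≫ D.buh (D.coh (𝟙 (D.bu D.uI A)) (D.buh (𝟙 D.uI) (eta ≫ dl))) (𝟙 A)
    ≫ eqToHom (show D.bu (D.co (D.bu D.uI A) (D.bu D.uI (D.bu A A))) A
        = D.bu (D.co (D.bu D.uI A) (D.bu (D.bu D.uI A) A)) A by simp [D.buA])
    ≫ D.buh (D.zt D.uI A (D.bu D.uI A) A) (𝟙 A)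
    ≫ eqToHom (show D.bu (D.bu (D.co D.uI (D.bu D.uI A)) (D.co A A)) A
        = D.bu (D.bu (D.bu D.uI A) (D.co A A)) A by simp [D.coL])
    ≫ D.buh (D.buh (𝟙 (D.bu D.uI A)) mu) (𝟙 A)
  = D.dlI ≫ D.buh (𝟙 D.uI) eta ≫ D.buh (𝟙 D.uI) dl
    ≫ eqToHom (show D.bu D.uI (D.bu A A) = D.bu (D.bu D.uI A) A by simp [D.buA])
    ≫ D.buh (𝟙 (D.bu D.uI A)) dl
    ≫ eqToHom (show D.bu (D.bu D.uI A) (D.bu A A)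
        = D.bu (D.bu (D.bu D.uI A) A) A by simp [D.buA])

/-- Axiom (LRU). -/
def LRUeq (A : M) (mu : D.co A A ⟶ A) (eta : D.uI ⟶ A) (dl : A ⟶ D.bu A A) : Prop :=
  D.dlI ≫ D.buh (eta ≫ dl) (𝟙 D.uI)
    ≫ eqToHom (show D.bu (D.bu A A) D.uI = D.bu A (D.co (D.bu A D.uI) D.uI) by
        simp [D.coR, D.buA])
    ≫ D.buh (𝟙 A) (D.coh (𝟙 (D.bu A D.uI)) D.dlI)
    ≫ D.buh (𝟙 A) (D.coh (𝟙 (D.bu A D.uI)) (D.buh (eta ≫ dl) (𝟙 D.uI)))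
    ≫ eqToHom (show D.bu A (D.co (D.bu A D.uI) (D.bu (D.bu A A) D.uI))
        = D.bu A (D.co (D.bu A D.uI) (D.bu A (D.bu A D.uI))) by simp [D.buA])
    ≫ D.buh (𝟙 A) (D.zt A D.uI A (D.bu A D.uI))
    ≫ eqToHom (show D.bu A (D.bu (D.co A A) (D.co D.uI (D.bu A D.uI)))
        = D.bu (D.bu (D.bu A (D.co A A)) A) D.uI by simp [D.coL, D.buA])
    ≫ D.buh (D.buh (D.buh (𝟙 A) mu) (𝟙 A)) (𝟙 D.uI)
  = D.dlI ≫ D.buh eta (𝟙 D.uI) ≫ D.buh dl (𝟙 D.uI) ≫ D.buh (D.buh dl (𝟙 A)) (𝟙 D.uI)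

/-- Axiom (LRC). -/
def LRCeq (A : M) (mu : D.co A A ⟶ A) (dl : A ⟶ D.bu A A) (ep : A ⟶ D.uJ) : Prop :=
  D.coh (D.coh (𝟙 (D.co D.uJ A)) dl) (𝟙 A)
    ≫ eqToHom (show D.co (D.co (D.co D.uJ A) (D.bu A A)) A
        = D.co (D.co (D.bu (D.co D.uJ A) D.uJ) (D.bu A A)) A by simp [D.buR])
    ≫ D.coh (D.zt (D.co D.uJ A) D.uJ A A) (𝟙 A)
    ≫ D.coh (D.buh (eqToHom (D.coA D.uJ A A) ≫ D.coh (𝟙 D.uJ) (mu ≫ ep))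
        (𝟙 (D.co D.uJ A))) (𝟙 A)
    ≫ D.coh (D.buh D.pw (𝟙 (D.co D.uJ A))) (𝟙 A)
    ≫ eqToHom (show D.co (D.bu D.uJ (D.co D.uJ A)) A = D.co D.uJ (D.co A A) by
        simp [D.buL, D.coA])
    ≫ D.coh (𝟙 D.uJ) (mu ≫ ep) ≫ D.pw
  = eqToHom (show D.co (D.co (D.co D.uJ A) A) A = D.co (D.co D.uJ A) (D.co A A) by
        simp [D.coA])
    ≫ D.coh (𝟙 (D.co D.uJ A)) mu
    ≫ eqToHom (D.coA D.uJ A A)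
    ≫ D.coh (𝟙 D.uJ) mu ≫ D.coh (𝟙 D.uJ) ep ≫ D.pw

/-- Axiom (LLC). -/
def LLCeq (A : M) (mu : D.co A A ⟶ A) (dl : A ⟶ D.bu A A) (ep : A ⟶ D.uJ) : Prop :=
  D.coh (D.coh (𝟙 (D.co D.uJ A)) dl) (𝟙 A)
    ≫ eqToHom (show D.co (D.co (D.co D.uJ A) (D.bu A A)) A
        = D.co (D.co (D.bu D.uJ (D.co D.uJ A)) (D.bu A A)) A by simp [D.buL])
    ≫ D.coh (D.zt D.uJ (D.co D.uJ A) A A) (𝟙 A)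
    ≫ D.coh (D.buh (𝟙 (D.co D.uJ A))
        (eqToHom (D.coA D.uJ A A) ≫ D.coh (𝟙 D.uJ) (mu ≫ ep))) (𝟙 A)
    ≫ D.coh (D.buh (𝟙 (D.co D.uJ A)) D.pw) (𝟙 A)
    ≫ eqToHom (show D.co (D.bu (D.co D.uJ A) D.uJ) A = D.co D.uJ (D.co A A) by
        simp [D.buR, D.coA])
    ≫ D.coh (𝟙 D.uJ) (mu ≫ ep) ≫ D.pw
  = eqToHom (show D.co (D.co (D.co D.uJ A) A) A = D.co (D.co D.uJ A) (D.co A A) by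
        simp [D.coA])
    ≫ D.coh (𝟙 (D.co D.uJ A)) mu
    ≫ eqToHom (D.coA D.uJ A A)
    ≫ D.coh (𝟙 D.uJ) mu ≫ D.coh (𝟙 D.uJ) ep ≫ D.pw

/-- Axiom (RLU), obtained from (RRU) by replacing `∘` by its opposite. -/
def RLUeq (A : M) (mu : D.co A A ⟶ A) (eta : D.uI ⟶ A) (dl : A ⟶ D.bu A A) : Prop :=
  D.dlI ≫ D.buh (𝟙 D.uI) (eta ≫ dl)
    ≫ eqToHom (show D.bu D.uI (D.bu A A) = D.bu (D.co D.uI (D.bu D.uI A)) A by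
        simp [D.coL, D.buA])
    ≫ D.buh (D.coh D.dlI (𝟙 (D.bu D.uI A))) (𝟙 A)
    ≫ D.buh (D.coh (D.buh (𝟙 D.uI) (eta ≫ dl)) (𝟙 (D.bu D.uI A))) (𝟙 A)
    ≫ eqToHom (show D.bu (D.co (D.bu D.uI (D.bu A A)) (D.bu D.uI A)) A
        = D.bu (D.co (D.bu (D.bu D.uI A) A) (D.bu D.uI A)) A by simp [D.buA])
    ≫ D.buh (D.zt (D.bu D.uI A) A D.uI A) (𝟙 A)
    ≫ eqToHom (show D.bu (D.bu (D.co (D.bu D.uI A) D.uI) (D.co A A)) A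
        = D.bu (D.bu (D.bu D.uI A) (D.co A A)) A by simp [D.coR])
    ≫ D.buh (D.buh (𝟙 (D.bu D.uI A)) mu) (𝟙 A)
  = D.dlI ≫ D.buh (𝟙 D.uI) eta ≫ D.buh (𝟙 D.uI) dl
    ≫ eqToHom (show D.bu D.uI (D.bu A A) = D.bu (D.bu D.uI A) A by simp [D.buA])
    ≫ D.buh (𝟙 (D.bu D.uI A)) dl
    ≫ eqToHom (show D.bu (D.bu D.uI A) (D.bu A A)
        = D.bu (D.bu (D.bu D.uI A) A) A by simp [D.buA])

/-- Axiom (LLU), obtained from (LRU) by replacing `∘` by its opposite. -/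
def LLUeq (A : M) (mu : D.co A A ⟶ A) (eta : D.uI ⟶ A) (dl : A ⟶ D.bu A A) : Prop :=
  D.dlI ≫ D.buh (eta ≫ dl) (𝟙 D.uI)
    ≫ eqToHom (show D.bu (D.bu A A) D.uI = D.bu A (D.co D.uI (D.bu A D.uI)) by
        simp [D.coL, D.buA])
    ≫ D.buh (𝟙 A) (D.coh D.dlI (𝟙 (D.bu A D.uI)))
    ≫ D.buh (𝟙 A) (D.coh (D.buh (eta ≫ dl) (𝟙 D.uI)) (𝟙 (D.bu A D.uI)))
    ≫ eqToHom (show D.bu A (D.co (D.bu (D.bu A A) D.uI) (D.bu A D.uI))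
        = D.bu A (D.co (D.bu A (D.bu A D.uI)) (D.bu A D.uI)) by simp [D.buA])
    ≫ D.buh (𝟙 A) (D.zt A (D.bu A D.uI) A D.uI)
    ≫ eqToHom (show D.bu A (D.bu (D.co A A) (D.co (D.bu A D.uI) D.uI))
        = D.bu (D.bu (D.bu A (D.co A A)) A) D.uI by simp [D.coR, D.buA])
    ≫ D.buh (D.buh (D.buh (𝟙 A) mu) (𝟙 A)) (𝟙 D.uI)
  = D.dlI ≫ D.buh eta (𝟙 D.uI) ≫ D.buh dl (𝟙 D.uI) ≫ D.buh (D.buh dl (𝟙 A)) (𝟙 D.uI)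

/-- Axiom (RRC), obtained from (LLC) by replacing `∘` by its opposite. -/
def RRCeq (A : M) (mu : D.co A A ⟶ A) (dl : A ⟶ D.bu A A) (ep : A ⟶ D.uJ) : Prop :=
  D.coh (D.coh (D.coh (𝟙 A) dl) (𝟙 A)) (𝟙 D.uJ)
    ≫ eqToHom (show D.co (D.co (D.co A (D.bu A A)) A) D.uJ
        = D.co A (D.co (D.bu A A) (D.bu (D.co A D.uJ) D.uJ)) by simp [D.coA, D.buR])
    ≫ D.coh (𝟙 A) (D.zt A A (D.co A D.uJ) D.uJ)
    ≫ D.coh (𝟙 A) (D.buh (eqToHom (D.coA A A D.uJ).symm ≫ D.coh (mu ≫ ep) (𝟙 D.uJ))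
        (𝟙 (D.co A D.uJ)))
    ≫ D.coh (𝟙 A) (D.buh D.pw (𝟙 (D.co A D.uJ)))
    ≫ eqToHom (show D.co A (D.bu D.uJ (D.co A D.uJ)) = D.co (D.co A A) D.uJ by
        simp [D.buL, D.coA])
    ≫ D.coh (mu ≫ ep) (𝟙 D.uJ) ≫ D.pw
  = D.coh (D.coh mu (𝟙 A)) (𝟙 D.uJ) ≫ D.coh mu (𝟙 D.uJ) ≫ D.coh ep (𝟙 D.uJ) ≫ D.pw

/-- Axiom (RLC), obtained from (LRC) by replacing `∘` by its opposite. -/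
def RLCeq (A : M) (mu : D.co A A ⟶ A) (dl : A ⟶ D.bu A A) (ep : A ⟶ D.uJ) : Prop :=
  D.coh (D.coh (D.coh (𝟙 A) dl) (𝟙 A)) (𝟙 D.uJ)
    ≫ eqToHom (show D.co (D.co (D.co A (D.bu A A)) A) D.uJ
        = D.co A (D.co (D.bu A A) (D.bu D.uJ (D.co A D.uJ))) by simp [D.coA, D.buL])
    ≫ D.coh (𝟙 A) (D.zt A A D.uJ (D.co A D.uJ))
    ≫ D.coh (𝟙 A) (D.buh (𝟙 (D.co A D.uJ))
        (eqToHom (D.coA A A D.uJ).symm ≫ D.coh (mu ≫ ep) (𝟙 D.uJ)))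
    ≫ D.coh (𝟙 A) (D.buh (𝟙 (D.co A D.uJ)) D.pw)
    ≫ eqToHom (show D.co A (D.bu (D.co A D.uJ) D.uJ) = D.co (D.co A A) D.uJ by
        simp [D.buR, D.coA])
    ≫ D.coh (mu ≫ ep) (𝟙 D.uJ) ≫ D.pw
  = D.coh (D.coh mu (𝟙 A)) (𝟙 D.uJ) ≫ D.coh mu (𝟙 D.uJ) ≫ D.coh ep (𝟙 D.uJ) ≫ D.pw

end Duo

/-- A right weak bimonoid in a duoidal category. -/
structure RWB {M : Type u} [Category.{v} M] (D : Duo M) where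
  A : M
  mu : D.co A A ⟶ A
  eta : D.uI ⟶ A
  dl : A ⟶ D.bu A A
  ep : A ⟶ D.uJ
  mu_assoc : D.coh mu (𝟙 A) ≫ mu = eqToHom (D.coA A A A) ≫ D.coh (𝟙 A) mu ≫ mu
  mu_unitL : eqToHom (D.coL A).symm ≫ D.coh eta (𝟙 A) ≫ mu = 𝟙 A
  mu_unitR : eqToHom (D.coR A).symm ≫ D.coh (𝟙 A) eta ≫ mu = 𝟙 A
  dl_coassoc : dl ≫ D.buh dl (𝟙 A) ≫ eqToHom (D.buA A A A) = dl ≫ D.buh (𝟙 A) dl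
  dl_counitL : dl ≫ D.buh ep (𝟙 A) ≫ eqToHom (D.buL A) = 𝟙 A
  dl_counitR : dl ≫ D.buh (𝟙 A) ep ≫ eqToHom (D.buR A) = 𝟙 A
  wb : D.WBeq A mu dl
  rru : D.RRUeq A mu eta dl
  lru : D.LRUeq A mu eta dl
  lrc : D.LRCeq A mu dl ep
  llc : D.LLCeq A mu dl ep

/-- A weak bimonoid: both a right weak bimonoid and a left weak bimonoid. -/
structure WBim {M : Type u} [Category.{v} M] (D : Duo M) extends RWB D where
  rlu : D.RLUeq A mu eta dl
  llu : D.LLUeq A mu eta dl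
  rlc : D.RLCeq A mu dl ep
  rrc : D.RRCeq A mu dl ep

/-- Idempotent morphisms split in `M`. -/
def SplitIdem (M : Type u) [Category.{v} M] : Prop :=
  ∀ ⦃X : M⦄ (e : X ⟶ X), e ≫ e = e →
    ∃ (Y : M) (p : X ⟶ Y) (i : Y ⟶ X), p ≫ i = e ∧ i ≫ p = 𝟙 Y

namespace CategoryTheory.Arrow

variable {M : Type u} [Category.{v} M]

/-- The identity arrow of an object. -/
def idA (X : M) : Arrow M := Arrow.mk (𝟙 X)

theorem mk_id (X : M) : Arrow.mk (𝟙 X) = idA X := rfl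

theorem idA_left (X : M) : (idA X).left = X := (rfl)

theorem idA_right (X : M) : (idA X).right = X := (rfl)

theorem mk_eqToHom {X Y : M} (h : X = Y) : Arrow.mk (eqToHom h) = idA X := by
  subst h; rfl

theorem mk_eqToHom_comp {X Y Z : M} (h : X = Y) (f : Y ⟶ Z) :
    Arrow.mk (eqToHom h ≫ f) = Arrow.mk f := by
  subst h; simp

theorem mk_comp_eqToHom {X Y Z : M} (f : X ⟶ Y) (h : Y = Z) :
    Arrow.mk (f ≫ eqToHom h) = Arrow.mk f := by
  subst h; simp

theorem eq_iff_mk_eq {X Y : M} (f g : X ⟶ Y) : f = g ↔ Arrow.mk f = Arrow.mk g :=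
  ⟨fun h => by rw [h], fun h => by cases h; rfl⟩

open Classical in
/-- Composition of arrows whose middle objects are propositionally equal;
the first arrow if they are not. -/
noncomputable def seq (x y : Arrow M) : Arrow M :=
  if h : x.right = y.left then Arrow.mk (x.hom ≫ eqToHom h ≫ y.hom) else x

theorem seq_mk {X Y Z : M} (f : X ⟶ Y) (g : Y ⟶ Z) :
    seq (Arrow.mk f) (Arrow.mk g) = Arrow.mk (f ≫ g) := by
  simp [seq]

theorem mk_comp {X Y Z : M} (f : X ⟶ Y) (g : Y ⟶ Z) :
    Arrow.mk (f ≫ g) = seq (Arrow.mk f) (Arrow.mk g) := (seq_mk f g).symm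

theorem seq_left (x y : Arrow M) : (seq x y).left = x.left := by
  unfold seq; split_ifs <;> rfl

theorem seq_right {x y : Arrow M} (h : x.right = y.left) : (seq x y).right = y.right := by
  simp [seq, h]

theorem exists_mk_of_right_eq_left (x y : Arrow M) (h : x.right = y.left) :
    ∃ (X Y Z : M) (f : X ⟶ Y) (g : Y ⟶ Z), x = Arrow.mk f ∧ y = Arrow.mk g := by
  obtain ⟨X, Y, f⟩ := x
  obtain ⟨Y', Z, g⟩ := y
  obtain rfl : Y = Y' := h
  exact ⟨X, Y, Z, f, g, rfl, rfl⟩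

theorem seq_assoc {x y z : Arrow M} (h : x.right = y.left) (h' : y.right = z.left) :
    seq (seq x y) z = seq x (seq y z) := by
  obtain ⟨X, Y, f⟩ := x
  obtain ⟨Y', Z, g⟩ := y
  obtain ⟨Z', W, k⟩ := z
  obtain rfl : Y = Y' := h
  obtain rfl : Z = Z' := h'
  change seq (seq (Arrow.mk f) (Arrow.mk g)) (Arrow.mk k)
    = seq (Arrow.mk f) (seq (Arrow.mk g) (Arrow.mk k))
  simp only [seq_mk, Category.assoc]

theorem id_seq {x : Arrow M} {X : M} (h : X = x.left) : seq (idA X) x = x := by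
  subst h
  exact (seq_mk _ x.hom).trans (by simp)

theorem seq_id {x : Arrow M} {X : M} (h : x.right = X) : seq x (idA X) = x := by
  subst h
  exact (seq_mk x.hom _).trans (by simp)

end CategoryTheory.Arrow

namespace Duo

open Arrow

variable {M : Type u} [Category.{v} M] (D : Duo M)

/-- The monoidal product `•` on arrows. -/
def tens (x y : Arrow M) : Arrow M := Arrow.mk (D.buh x.hom y.hom)

theorem mk_buh {X Y X' Y' : M} (f : X ⟶ Y) (g : X' ⟶ Y') :
    Arrow.mk (D.buh f g) = D.tens (Arrow.mk f) (Arrow.mk g) := rfl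

theorem tens_left (x y : Arrow M) : (D.tens x y).left = D.bu x.left y.left := (rfl)

theorem tens_right (x y : Arrow M) : (D.tens x y).right = D.bu x.right y.right := (rfl)

theorem tens_assoc (x y z : Arrow M) :
    D.tens (D.tens x y) z = D.tens x (D.tens y z) := by
  change Arrow.mk (D.buh (D.buh x.hom y.hom) z.hom) = _
  rw [D.buh_assoc, mk_eqToHom_comp, mk_comp_eqToHom]
  rfl

theorem tens_one (x : Arrow M) : D.tens x (idA D.uJ) = x := by
  change Arrow.mk (D.buh x.hom (𝟙 D.uJ)) = _
  rw [D.buh_unitR, mk_eqToHom_comp, mk_comp_eqToHom]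
  rfl

theorem one_tens (x : Arrow M) : D.tens (idA D.uJ) x = x := by
  change Arrow.mk (D.buh (𝟙 D.uJ) x.hom) = _
  rw [D.buh_unitL, mk_eqToHom_comp, mk_comp_eqToHom]
  rfl

theorem idA_bu (X Y : M) :
    idA (D.bu X Y) = D.tens (idA X) (idA Y) := by
  rw [idA, ← D.buh_id]; rfl

theorem tens_seq {x y x' y' : Arrow M} (h : x.right = y.left) (h' : x'.right = y'.left) :
    D.tens (seq x y) (seq x' y') = seq (D.tens x x') (D.tens y y') := by
  obtain ⟨X, Y, Z, f, g, rfl, rfl⟩ := exists_mk_of_right_eq_left x y h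
  obtain ⟨X', Y', Z', f', g', rfl, rfl⟩ := exists_mk_of_right_eq_left x' y' h'
  simp only [seq_mk, ← mk_buh, D.buh_comp]

/-- The monoidal product `∘` on arrows. -/
def coTens (x y : Arrow M) : Arrow M := Arrow.mk (D.coh x.hom y.hom)

theorem mk_coh {X Y X' Y' : M} (f : X ⟶ Y) (g : X' ⟶ Y') :
    Arrow.mk (D.coh f g) = D.coTens (Arrow.mk f) (Arrow.mk g) := rfl

theorem coTens_one (x : Arrow M) : D.coTens x (idA D.uI) = x := by
  change Arrow.mk (D.coh x.hom (𝟙 D.uI)) = _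
  rw [D.coh_unitR, mk_eqToHom_comp, mk_comp_eqToHom]
  rfl

theorem one_coTens (x : Arrow M) : D.coTens (idA D.uI) x = x := by
  change Arrow.mk (D.coh (𝟙 D.uI) x.hom) = _
  rw [D.coh_unitL, mk_eqToHom_comp, mk_comp_eqToHom]
  rfl

/-- A braiding for the monoidal product `•`. -/
structure Braiding where
  hom : ∀ X Y : M, D.bu X Y ⟶ D.bu Y X
  inv : ∀ X Y : M, D.bu X Y ⟶ D.bu Y X
  hom_inv : ∀ X Y : M, hom X Y ≫ inv Y X = 𝟙 (D.bu X Y)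
  inv_hom : ∀ X Y : M, inv X Y ≫ hom Y X = 𝟙 (D.bu X Y)
  naturality : ∀ {X X' Y Y' : M} (f : X ⟶ X') (g : Y ⟶ Y'),
    D.buh f g ≫ hom X' Y' = hom X Y ≫ D.buh g f
  hexagon_left : ∀ X Y Z : M, hom (D.bu X Y) Z
    = eqToHom (D.buA X Y Z) ≫ D.buh (𝟙 X) (hom Y Z) ≫ eqToHom (D.buA X Z Y).symm
      ≫ D.buh (hom X Z) (𝟙 Y) ≫ eqToHom (D.buA Z X Y)
  hexagon_right : ∀ X Y Z : M, hom X (D.bu Y Z)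
    = eqToHom (D.buA X Y Z).symm ≫ D.buh (hom X Y) (𝟙 Z) ≫ eqToHom (D.buA Y X Z)
      ≫ D.buh (𝟙 Y) (hom X Z) ≫ eqToHom (D.buA Y Z X).symm

theorem mk_comp_eqToHom_comp {X Y Y' Z : M} (f : X ⟶ Y) (h : Y = Y') (g : Y' ⟶ Z) :
    Arrow.mk (f ≫ eqToHom h ≫ g) = seq (Arrow.mk f) (Arrow.mk g) := by
  rw [mk_comp, mk_eqToHom_comp]

namespace Braiding

variable {D} (B : D.Braiding)

/-- The braiding as an arrow. -/
def braid (X Y : M) : Arrow M := Arrow.mk (B.hom X Y)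

/-- The inverse braiding as an arrow. -/
def unbraid (X Y : M) : Arrow M := Arrow.mk (B.inv X Y)

theorem braid_left (X Y : M) : (B.braid X Y).left = D.bu X Y := (rfl)
theorem braid_right (X Y : M) : (B.braid X Y).right = D.bu Y X := (rfl)
theorem unbraid_left (X Y : M) : (B.unbraid X Y).left = D.bu X Y := (rfl)
theorem unbraid_right (X Y : M) : (B.unbraid X Y).right = D.bu Y X := (rfl)

theorem braid_unbraid (X Y : M) :
    seq (B.braid X Y) (B.unbraid Y X) = idA (D.bu X Y) := by
  rw [braid, unbraid, seq_mk, B.hom_inv, mk_id]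

theorem unbraid_braid (X Y : M) :
    seq (B.unbraid X Y) (B.braid Y X) = idA (D.bu X Y) := by
  rw [braid, unbraid, seq_mk, B.inv_hom, mk_id]

theorem tens_braid (x y : Arrow M) :
    seq (D.tens x y) (B.braid x.right y.right) = seq (B.braid x.left y.left) (D.tens y x) := by
  change seq (Arrow.mk (D.buh x.hom y.hom)) (Arrow.mk _)
    = seq (Arrow.mk _) (Arrow.mk (D.buh y.hom x.hom))
  rw [seq_mk, seq_mk, B.naturality]

theorem braid_bu_left (X Y Z : M) : B.braid (D.bu X Y) Z
    = seq (D.tens (idA X) (B.braid Y Z)) (D.tens (B.braid X Z) (idA Y)) := by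
  rw [braid, B.hexagon_left, mk_eqToHom_comp, mk_comp_eqToHom_comp, mk_comp_eqToHom]
  rfl

theorem braid_bu_right (X Y Z : M) : B.braid X (D.bu Y Z)
    = seq (D.tens (B.braid X Y) (idA Z)) (D.tens (idA Y) (B.braid X Z)) := by
  rw [braid, B.hexagon_right, mk_eqToHom_comp, mk_comp_eqToHom_comp, mk_comp_eqToHom]
  rfl

theorem eq_id_of_seq_self {X Y : M} (h : D.bu X Y = D.bu Y X)
    (hs : B.braid X Y = seq (B.braid X Y) (B.braid X Y)) :
    B.braid X Y = idA (D.bu X Y) := by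
  have key := B.unbraid_braid Y X
  rw [hs, ← Arrow.seq_assoc (by rw [unbraid_right, braid_left])
      (by rw [braid_left, braid_right, h]),
    B.unbraid_braid, id_seq (by rw [braid_left, h])] at key
  rw [key, h]

theorem braid_one_left (Z : M) : B.braid D.uJ Z = idA Z := by
  rw [B.eq_id_of_seq_self (by rw [D.buL, D.buR]), D.buL]
  have := B.braid_bu_left D.uJ D.uJ Z
  rwa [D.buL, D.one_tens, D.tens_one] at this

theorem braid_one_right (Z : M) : B.braid Z D.uJ = idA Z := by
  rw [B.eq_id_of_seq_self (by rw [D.buL, D.buR]), D.buR]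
  have := B.braid_bu_right Z D.uJ D.uJ
  rwa [D.buL, D.one_tens, D.tens_one] at this

end Braiding

/-- The interchange law is induced by a braiding, and the structure morphisms on the
units are identities. -/
structure IsBraided {M : Type u} [Category.{v} M] (D : Duo M) (B : D.Braiding) : Prop where
  co_eq : D.co = D.bu
  uI_eq : D.uI = D.uJ
  mk_dlI : Arrow.mk D.dlI = idA D.uJ
  mk_pw : Arrow.mk D.pw = idA D.uJ
  mk_zt : ∀ X Y Z W : M, Arrow.mk (D.zt X Y Z W)
    = D.tens (idA X) (D.tens (B.braid Y Z) (idA W))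

namespace IsBraided

variable {M : Type u} [Category.{v} M] {D : Duo M} {B : D.Braiding}

theorem coTens_eq_tens (h : D.IsBraided B) (x y : Arrow M) : D.coTens x y = D.tens x y := by
  obtain ⟨X, X', f⟩ := x
  obtain ⟨Y, Y', g⟩ := y
  change D.coTens (Arrow.mk f) (Arrow.mk g) = D.tens (Arrow.mk f) (Arrow.mk g)
  have key := congrArg Arrow.mk (D.zt_nat f (𝟙 D.uJ) (𝟙 D.uJ) g)
  have h1 (x : Arrow M) : D.coTens x (idA D.uJ) = x := by
    rw [← h.uI_eq, D.coTens_one]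
  have h2 (x : Arrow M) : D.coTens (idA D.uJ) x = x := by
    rw [← h.uI_eq, D.one_coTens]
  simp only [mk_comp, mk_coh, mk_buh, h.mk_zt, B.braid_one_left, D.one_tens, D.tens_one,
    h1, h2, mk_id, ← D.idA_bu] at key
  rwa [seq_id, id_seq] at key
  · simp [tens_left]
  · simp [coTens, h.co_eq]

theorem mk_coh_eq (h : D.IsBraided B) {X Y X' Y' : M} (f : X ⟶ Y) (g : X' ⟶ Y') :
    Arrow.mk (D.coh f g) = D.tens (Arrow.mk f) (Arrow.mk g) := by
  rw [mk_coh, h.coTens_eq_tens]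

theorem RRUeq_iff (h : D.IsBraided B) (A : M) (mu : D.co A A ⟶ A)
    (eta : D.uI ⟶ A) (dl : A ⟶ D.bu A A) :
    D.RRUeq A mu eta dl ↔
      seq (seq (Arrow.mk eta) (Arrow.mk dl))
        (seq (D.tens (idA A) (D.tens (seq (Arrow.mk eta) (Arrow.mk dl)) (idA A)))
          (seq (D.tens (B.braid A A) (D.tens (idA A) (idA A)))
            (D.tens (idA A) (D.tens (Arrow.mk mu) (idA A)))))
      = seq (Arrow.mk eta) (seq (Arrow.mk dl) (D.tens (idA A) (Arrow.mk dl))) := by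
  rw [RRUeq, eq_iff_mk_eq]
  simp only [mk_comp, mk_buh, h.mk_coh_eq, h.mk_dlI, h.mk_zt, mk_id, mk_eqToHom,
    h.co_eq, h.uI_eq, D.buL, D.buA, D.one_tens, D.tens_one, D.tens_assoc]
  simp only [← D.idA_bu, seq_id, id_seq, D.tens_right, D.tens_left, idA_left, idA_right,
    Arrow.mk_left, Arrow.mk_right, seq_left, D.buA, D.buL, h.co_eq, h.uI_eq,
    B.braid_left]

theorem LRUeq_iff (h : D.IsBraided B) (A : M) (mu : D.co A A ⟶ A)
    (eta : D.uI ⟶ A) (dl : A ⟶ D.bu A A) :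
    D.LRUeq A mu eta dl ↔
      seq (seq (Arrow.mk eta) (Arrow.mk dl))
        (seq (D.tens (idA A) (D.tens (idA A) (seq (Arrow.mk eta) (Arrow.mk dl))))
          (D.tens (idA A) (D.tens (Arrow.mk mu) (idA A))))
      = seq (Arrow.mk eta) (seq (Arrow.mk dl) (D.tens (Arrow.mk dl) (idA A))) := by
  rw [LRUeq, eq_iff_mk_eq]
  simp only [mk_comp, mk_buh, h.mk_coh_eq, h.mk_dlI, h.mk_zt, mk_id, mk_eqToHom,
    h.co_eq, h.uI_eq, D.buL, D.buR, D.buA, D.tens_one, D.tens_assoc, B.braid_one_left]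
  simp only [← D.idA_bu, id_seq, D.tens_left, idA_left, Arrow.mk_left, seq_left,
    D.buA, D.buR, h.co_eq, h.uI_eq]

theorem LRCeq_iff (h : D.IsBraided B) (A : M) (mu : D.co A A ⟶ A)
    (dl : A ⟶ D.bu A A) (ep : A ⟶ D.uJ) :
    D.LRCeq A mu dl ep ↔
      seq (D.tens (idA A) (D.tens (Arrow.mk dl) (idA A)))
        (seq (D.tens (seq (Arrow.mk mu) (Arrow.mk ep)) (D.tens (idA A) (idA A)))
          (seq (Arrow.mk mu) (Arrow.mk ep)))
      = seq (D.tens (idA A) (Arrow.mk mu)) (seq (Arrow.mk mu) (Arrow.mk ep)) := by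
  rw [LRCeq, eq_iff_mk_eq]
  simp only [mk_comp, mk_buh, h.mk_coh_eq, h.mk_pw, h.mk_zt, mk_id, mk_eqToHom,
    h.co_eq, D.buL, D.buA, D.one_tens, D.tens_assoc, B.braid_one_left]
  simp only [← D.idA_bu, seq_id, id_seq, D.tens_left, idA_left,
    Arrow.mk_left, Arrow.mk_right, seq_left, seq_right, D.buA, h.co_eq]

theorem LLCeq_iff (h : D.IsBraided B) (A : M) (mu : D.co A A ⟶ A)
    (dl : A ⟶ D.bu A A) (ep : A ⟶ D.uJ) :
    D.LLCeq A mu dl ep ↔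
      seq (D.tens (idA A) (D.tens (Arrow.mk dl) (idA A)))
        (seq (D.tens (B.braid A A) (D.tens (idA A) (idA A)))
          (seq (D.tens (idA A) (D.tens (seq (Arrow.mk mu) (Arrow.mk ep)) (idA A)))
            (seq (Arrow.mk mu) (Arrow.mk ep))))
      = seq (D.tens (idA A) (Arrow.mk mu)) (seq (Arrow.mk mu) (Arrow.mk ep)) := by
  rw [LLCeq, eq_iff_mk_eq]
  simp only [mk_comp, mk_buh, h.mk_coh_eq, h.mk_pw, h.mk_zt, mk_id, mk_eqToHom,
    h.co_eq, D.buL, D.buR, D.buA, D.one_tens, D.tens_one, D.tens_assoc]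
  simp only [← D.idA_bu, seq_id, id_seq, D.tens_left, idA_left,
    Arrow.mk_left, Arrow.mk_right, seq_left, seq_right, D.buA, h.co_eq, B.braid_left]

end IsBraided

variable {M : Type u} [Category.{v} M] {D : Duo M}

attribute [local simp] tens_left tens_right seq_left seq_right idA_left idA_right
  Braiding.braid_left Braiding.braid_right Braiding.unbraid_left Braiding.unbraid_right
  buA buL buR

theorem idA_tens_seq {x y : Arrow M} (X : M) (hxy : x.right = y.left) :
    D.tens (idA X) (seq x y) = seq (D.tens (idA X) x) (D.tens (idA X) y) := by
  rw [← D.tens_seq (by simp) hxy, id_seq (x := idA X) (by simp)]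

theorem seq_tens_idA {x y : Arrow M} (X : M) (hxy : x.right = y.left) :
    D.tens (seq x y) (idA X) = seq (D.tens x (idA X)) (D.tens y (idA X)) := by
  rw [← D.tens_seq hxy (by simp), id_seq (x := idA X) (by simp)]

theorem seq_tens_of_left_eq_one {x y : Arrow M} {X : M} (hx : x.left = D.uJ)
    (hy : y.right = X) : seq y (D.tens x (idA X)) = D.tens x y := by
  conv_lhs => rw [← D.one_tens y]
  rw [← D.tens_seq (by simp [hx]) (by simp [hy]), id_seq hx.symm, seq_id hy]

theorem seq_tens_idA_of_left_eq_one {x y : Arrow M} {X : M} (hx : x.left = D.uJ)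
    (hy : y.right = X) : seq y (D.tens (idA X) x) = D.tens y x := by
  conv_lhs => rw [← D.tens_one y]
  rw [← D.tens_seq (by simp [hy]) (by simp [hx]), id_seq hx.symm, seq_id hy]

theorem tens_seq_of_right_eq_one {x y : Arrow M} {X : M} (hx : x.right = D.uJ)
    (hy : y.left = X) : seq (D.tens x (idA X)) y = D.tens x y := by
  conv_lhs => rw [← D.one_tens y]
  rw [← D.tens_seq (by simp [hx]) (by simp [hy]), id_seq hy.symm, seq_id hx]

namespace Braiding

variable (B : D.Braiding) (X : M)

theorem tens_braid_of_left_eq_one {u : Arrow M} (hu : u.left = D.uJ)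
    (hu' : u.right = D.bu X X) :
    seq (D.tens (idA X) u) (D.tens (B.braid X X) (idA X))
      = seq (D.tens u (idA X)) (D.tens (idA X) (B.unbraid X X)) := by
  have key := B.tens_braid (idA X) u
  rw [hu, hu', idA_left, idA_right, B.braid_one_right, id_seq (by simp [hu]),
    B.braid_bu_right] at key
  rw [← key, Arrow.seq_assoc (by simp [hu']) (by simp), Arrow.seq_assoc (by simp) (by simp),
    ← idA_tens_seq X (by simp), B.braid_unbraid, ← idA_bu, seq_id (by simp)]

theorem braid_tens_of_right_eq_one {p : Arrow M} (hp : p.right = D.uJ)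
    (hp' : p.left = D.bu X X) :
    seq (D.tens (B.braid X X) (idA X)) (D.tens (idA X) p)
      = seq (D.tens (idA X) (B.unbraid X X)) (D.tens p (idA X)) := by
  have key := B.tens_braid p (idA X)
  rw [hp, hp', idA_left, idA_right, B.braid_one_left, seq_id (by simp [hp]),
    B.braid_bu_left] at key
  rw [key, ← Arrow.seq_assoc (by simp) (by simp [hp']), ← Arrow.seq_assoc (by simp) (by simp),
    ← idA_tens_seq X (by simp), B.unbraid_braid, ← idA_bu, id_seq (by simp)]

theorem unit_seq_braid {u m : Arrow M} (hu : u.left = D.uJ) (hu' : u.right = D.bu X X)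
    (hm : m.left = D.bu X X) :
    seq u (seq (D.tens (idA X) (D.tens u (idA X)))
      (seq (D.tens (B.braid X X) (D.tens (idA X) (idA X)))
        (D.tens (idA X) (D.tens m (idA X)))))
      = seq (D.tens u u) (D.tens (idA X) (D.tens (seq (B.unbraid X X) m) (idA X))) := by
  rw [← Arrow.seq_assoc (y := D.tens (B.braid X X) _) (by simp [hu']) (by simp [hm]),
    ← D.tens_assoc, ← D.tens_assoc (B.braid X X), ← seq_tens_idA X (by simp [hu']),
    B.tens_braid_of_left_eq_one X hu hu', seq_tens_idA X (by simp [hu']), D.tens_assoc,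
    ← D.idA_bu, Arrow.seq_assoc (by simp [hu']) (by simp [hm]),
    ← Arrow.seq_assoc (by simp [hu, hu']) (by simp [hu']),
    seq_tens_of_left_eq_one hu hu', D.tens_assoc, ← idA_tens_seq X (by simp [hm]),
    ← seq_tens_idA X (by simp [hm])]

theorem unit_seq {u m : Arrow M} (hu : u.left = D.uJ) (hu' : u.right = D.bu X X)
    (hm : m.left = D.bu X X) :
    seq u (seq (D.tens (idA X) (D.tens (idA X) u)) (D.tens (idA X) (D.tens m (idA X))))
      = seq (D.tens u u) (D.tens (idA X) (D.tens m (idA X))) := by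
  rw [← D.tens_assoc, ← D.idA_bu, ← Arrow.seq_assoc (by simp [hu, hu']) (by simp [hu', hm]),
    seq_tens_idA_of_left_eq_one hu hu']

theorem seq_counit {d p : Arrow M} (hp : p.left = D.bu X X) (hp' : p.right = D.uJ) :
    seq (D.tens (idA X) (D.tens d (idA X))) (seq (D.tens p (D.tens (idA X) (idA X))) p)
      = seq (D.tens (idA X) (D.tens d (idA X))) (D.tens p p) := by
  rw [← D.idA_bu, tens_seq_of_right_eq_one hp' hp]

theorem seq_braid_counit {d p : Arrow M} (hd : d.right = D.bu X X)
    (hp : p.left = D.bu X X) (hp' : p.right = D.uJ) :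
    seq (D.tens (idA X) (D.tens d (idA X)))
      (seq (D.tens (B.braid X X) (D.tens (idA X) (idA X)))
        (seq (D.tens (idA X) (D.tens p (idA X))) p))
      = seq (D.tens (idA X) (D.tens (seq d (B.unbraid X X)) (idA X))) (D.tens p p) := by
  rw [← Arrow.seq_assoc (x := D.tens (B.braid X X) _) (by simp [hp]) (by simp [hp, hp']),
    ← D.tens_assoc (B.braid X X), ← D.tens_assoc (idA X) p, ← seq_tens_idA X (by simp [hp]),
    B.braid_tens_of_right_eq_one X hp' hp, seq_tens_idA X (by simp [hp]), D.tens_assoc,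
    D.tens_assoc, Arrow.seq_assoc (by simp [hp]) (by simp [hp, hp']),
    ← D.idA_bu, tens_seq_of_right_eq_one hp' hp,
    ← Arrow.seq_assoc (by simp [hd]) (by simp [hp]),
    ← idA_tens_seq X (by simp [hd]), ← seq_tens_idA X (by simp [hd])]

end Braiding
end Duo

/-- Let `(M,⊗,K,σ)` be a (strict) braided monoidal category, regarded
as a duoidal category with both monoidal products equal to `⊗`, with `δ, ϖ, τ` the
identity coherences on the unit, and with interchange `ζ = A⊗σ_{B,C}⊗D`.  If `A`
carries a monoid structure `(μ,η)` and a comonoid structure `(Δ,ε)` satisfying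
`Δ.μ = (μ⊗μ).(A⊗σ_{A,A}⊗A).(Δ⊗Δ)`, then `A` is a weak bimonoid in the sense of
Pastro–Street if and only if `A` is a right weak bimonoid in this duoidal category,
i.e. iff the axioms (RRU), (LRU), (LRC), (LLC) hold. -/
theorem pastro_street_iff_right_weak_bimonoid
    {M : Type u} [Category.{v} M] (D : Duo M)
    (hco : D.co = D.bu) (hI : D.uI = D.uJ)
    (hdl : D.dlI = eqToHom (show D.uI = D.bu D.uI D.uI by rw [hI, D.buL]))
    (hpw : D.pw = eqToHom (show D.co D.uJ D.uJ = D.uJ by rw [hco, D.buL]))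
    (htau : D.tau = eqToHom hI)
    -- the braiding and its inverse
    (σ : ∀ X Y : M, D.bu X Y ⟶ D.bu Y X)
    (σi : ∀ X Y : M, D.bu X Y ⟶ D.bu Y X)
    (hσiso : ∀ X Y : M, σ X Y ≫ σi Y X = 𝟙 (D.bu X Y) ∧ σi X Y ≫ σ Y X = 𝟙 (D.bu X Y))
    (hσnat : ∀ {X X' Y Y' : M} (f : X ⟶ X') (g : Y ⟶ Y'),
      D.buh f g ≫ σ X' Y' = σ X Y ≫ D.buh g f)
    (hhex1 : ∀ X Y Z : M, σ (D.bu X Y) Z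
      = eqToHom (D.buA X Y Z) ≫ D.buh (𝟙 X) (σ Y Z) ≫ eqToHom (D.buA X Z Y).symm
          ≫ D.buh (σ X Z) (𝟙 Y) ≫ eqToHom (D.buA Z X Y))
    (hhex2 : ∀ X Y Z : M, σ X (D.bu Y Z)
      = eqToHom (D.buA X Y Z).symm ≫ D.buh (σ X Y) (𝟙 Z) ≫ eqToHom (D.buA Y X Z)
          ≫ D.buh (𝟙 Y) (σ X Z) ≫ eqToHom (D.buA Y Z X).symm)
    -- the interchange law is induced by the braiding:  ζ = A ⊗ σ_{B,C} ⊗ E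
    (hzt : ∀ A B C E : M, D.zt A B C E
      = eqToHom (show D.co (D.bu A B) (D.bu C E) = D.bu (D.bu A (D.bu B C)) E by
          rw [hco]; simp [D.buA])
        ≫ D.buh (D.buh (𝟙 A) (σ B C)) (𝟙 E)
        ≫ eqToHom (show D.bu (D.bu A (D.bu C B)) E = D.bu (D.co A C) (D.co B E) by
          rw [hco]; simp [D.buA]))
    -- the (co)monoid data on A
    (A : M) (mu : D.co A A ⟶ A) (eta : D.uI ⟶ A) (dl : A ⟶ D.bu A A) (ep : A ⟶ D.uJ)
    (mu_assoc : D.coh mu (𝟙 A) ≫ mu = eqToHom (D.coA A A A) ≫ D.coh (𝟙 A) mu ≫ mu)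
    (mu_unitL : eqToHom (D.coL A).symm ≫ D.coh eta (𝟙 A) ≫ mu = 𝟙 A)
    (mu_unitR : eqToHom (D.coR A).symm ≫ D.coh (𝟙 A) eta ≫ mu = 𝟙 A)
    (dl_coassoc : dl ≫ D.buh dl (𝟙 A) ≫ eqToHom (D.buA A A A) = dl ≫ D.buh (𝟙 A) dl)
    (dl_counitL : dl ≫ D.buh ep (𝟙 A) ≫ eqToHom (D.buL A) = 𝟙 A)
    (dl_counitR : dl ≫ D.buh (𝟙 A) ep ≫ eqToHom (D.buR A) = 𝟙 A)
    -- Δ.μ = (μ⊗μ).(A⊗σ⊗A).(Δ⊗Δ)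
    (hWB : D.WBeq A mu dl) :
    -- the Pastro–Street weak bimonoid axioms …
    (((eta ≫ dl ≫ D.buh dl (𝟙 A)
        = eqToHom (show D.uI = D.bu D.uI D.uI by rw [hI, D.buL])
          ≫ D.buh (eta ≫ dl) (eta ≫ dl)
          ≫ eqToHom (show D.bu (D.bu A A) (D.bu A A)
              = D.bu A (D.bu (D.bu A A) A) by simp [D.buA])
          ≫ D.buh (𝟙 A) (D.buh (eqToHom (show D.bu A A = D.co A A by rw [hco]) ≫ mu)
              (𝟙 A))
          ≫ eqToHom (show D.bu A (D.bu A A) = D.bu (D.bu A A) A by simp [D.buA])) ∧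
      (eta ≫ dl ≫ D.buh dl (𝟙 A)
        = eqToHom (show D.uI = D.bu D.uI D.uI by rw [hI, D.buL])
          ≫ D.buh (eta ≫ dl) (eta ≫ dl)
          ≫ eqToHom (show D.bu (D.bu A A) (D.bu A A)
              = D.bu A (D.bu (D.bu A A) A) by simp [D.buA])
          ≫ D.buh (𝟙 A)
              (D.buh (σi A A ≫ eqToHom (show D.bu A A = D.co A A by rw [hco]) ≫ mu)
              (𝟙 A))
          ≫ eqToHom (show D.bu A (D.bu A A) = D.bu (D.bu A A) A by simp [D.buA]))) ∧
     ((D.buh (eqToHom (show D.bu A A = D.co A A by rw [hco]) ≫ mu) (𝟙 A)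
          ≫ eqToHom (show D.bu A A = D.co A A by rw [hco]) ≫ mu ≫ ep
        = eqToHom (show D.bu (D.bu A A) A = D.bu A (D.bu A A) by simp [D.buA])
          ≫ D.buh (𝟙 A) (D.buh dl (𝟙 A))
          ≫ eqToHom (show D.bu A (D.bu (D.bu A A) A)
              = D.bu (D.bu A A) (D.bu A A) by simp [D.buA])
          ≫ D.buh (eqToHom (show D.bu A A = D.co A A by rw [hco]) ≫ mu ≫ ep)
              (eqToHom (show D.bu A A = D.co A A by rw [hco]) ≫ mu ≫ ep)
          ≫ eqToHom (D.buL D.uJ)) ∧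
      (D.buh (eqToHom (show D.bu A A = D.co A A by rw [hco]) ≫ mu) (𝟙 A)
          ≫ eqToHom (show D.bu A A = D.co A A by rw [hco]) ≫ mu ≫ ep
        = eqToHom (show D.bu (D.bu A A) A = D.bu A (D.bu A A) by simp [D.buA])
          ≫ D.buh (𝟙 A) (D.buh (dl ≫ σi A A) (𝟙 A))
          ≫ eqToHom (show D.bu A (D.bu (D.bu A A) A)
              = D.bu (D.bu A A) (D.bu A A) by simp [D.buA])
          ≫ D.buh (eqToHom (show D.bu A A = D.co A A by rw [hco]) ≫ mu ≫ ep)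
              (eqToHom (show D.bu A A = D.co A A by rw [hco]) ≫ mu ≫ ep)
          ≫ eqToHom (D.buL D.uJ))))
    -- … hold if and only if the right weak bimonoid axioms hold
    ↔ (D.RRUeq A mu eta dl ∧ D.LRUeq A mu eta dl ∧
        D.LRCeq A mu dl ep ∧ D.LLCeq A mu dl ep) := by
  let B : D.Braiding := ⟨σ, σi, fun X Y => (hσiso X Y).1, fun X Y => (hσiso X Y).2,
    hσnat, hhex1, hhex2⟩
  have h : D.IsBraided B :=
    { co_eq := hco
      uI_eq := hI
      mk_dlI := by rw [hdl, Arrow.mk_eqToHom, hI]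
      mk_pw := by rw [hpw, Arrow.mk_eqToHom, hco, D.buL]
      mk_zt := fun X Y Z W => by
        rw [hzt, Arrow.mk_eqToHom_comp, Arrow.mk_comp_eqToHom, D.mk_buh, D.mk_buh, D.tens_assoc]
        rfl }
  have hm : (Arrow.mk mu).left = D.bu A A := congrFun₂ hco A A
  have hu : (Arrow.seq (Arrow.mk eta) (Arrow.mk dl)).left = D.uJ := by
    rw [Arrow.seq_left]; exact hI
  have hu' : (Arrow.seq (Arrow.mk eta) (Arrow.mk dl)).right = D.bu A A := by
    rw [Arrow.seq_right (by rfl)]; rfl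
  have hp : (Arrow.seq (Arrow.mk mu) (Arrow.mk ep)).left = D.bu A A := by
    rw [Arrow.seq_left]; exact hm
  have hp' : (Arrow.seq (Arrow.mk mu) (Arrow.mk ep)).right = D.uJ := by
    rw [Arrow.seq_right (by rfl)]; rfl
  have hσ : B.unbraid A A = Arrow.mk (σi A A) := rfl
  have assoc : Arrow.seq (D.tens (Arrow.mk mu) (Arrow.idA A)) (Arrow.mk mu)
      = Arrow.seq (D.tens (Arrow.idA A) (Arrow.mk mu)) (Arrow.mk mu) := by
    have := congrArg Arrow.mk mu_assoc
    rw [Arrow.mk_eqToHom_comp] at this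
    simpa only [Arrow.mk_comp, h.mk_coh_eq, Arrow.mk_id] using this
  have assoc_counit : Arrow.seq (D.tens (Arrow.idA A) (Arrow.mk mu))
        (Arrow.seq (Arrow.mk mu) (Arrow.mk ep))
      = Arrow.seq (D.tens (Arrow.mk mu) (Arrow.idA A))
        (Arrow.seq (Arrow.mk mu) (Arrow.mk ep)) := by
    rw [← Arrow.seq_assoc hm.symm rfl, ← assoc, Arrow.seq_assoc hm.symm rfl]
  have coassoc : Arrow.seq (Arrow.mk dl) (D.tens (Arrow.mk dl) (Arrow.idA A))
      = Arrow.seq (Arrow.mk dl) (D.tens (Arrow.idA A) (Arrow.mk dl)) := by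
    have := congrArg Arrow.mk dl_coassoc
    rw [← Category.assoc, Arrow.mk_comp_eqToHom] at this
    simpa only [Arrow.mk_comp, D.mk_buh, Arrow.mk_id] using this
  refine Iff.trans (b := (D.LRUeq A mu eta dl ∧ D.RRUeq A mu eta dl) ∧
    D.LRCeq A mu dl ep ∧ D.LLCeq A mu dl ep)
    (and_congr (and_congr ?_ ?_) (and_congr ?_ ?_)) (by tauto)
  · rw [h.LRUeq_iff, Duo.Braiding.unit_seq A hu hu' hm, Arrow.eq_iff_mk_eq, eq_comm]
    simp [Arrow.mk_comp, D.mk_buh, Arrow.mk_id, Arrow.mk_eqToHom, Arrow.id_seq, Arrow.seq_id,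
      Arrow.seq_left, Arrow.idA_left, Arrow.idA_right, D.tens_left, D.tens_right, D.buA, D.buL,
      hI, hco]
  · rw [h.RRUeq_iff, B.unit_seq_braid A hu hu' hm, Arrow.eq_iff_mk_eq, eq_comm, ← coassoc, hσ]
    simp [Arrow.mk_comp, D.mk_buh, Arrow.mk_id, Arrow.mk_eqToHom, Arrow.id_seq, Arrow.seq_id,
      Arrow.seq_left, Arrow.seq_right, Arrow.idA_left, Arrow.idA_right, D.tens_left,
      D.tens_right, D.buA, D.buL, hI, hco]
  · rw [h.LRCeq_iff, Duo.Braiding.seq_counit A hp hp', Arrow.eq_iff_mk_eq, eq_comm,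
      assoc_counit]
    simp [Arrow.mk_comp, D.mk_buh, Arrow.mk_id, Arrow.mk_eqToHom, Arrow.id_seq, Arrow.seq_id,
      Arrow.seq_left, Arrow.seq_right, Arrow.idA_left, D.tens_left, D.tens_right, D.buA, D.buL, hco]
  · rw [h.LLCeq_iff, B.seq_braid_counit A rfl hp hp', Arrow.eq_iff_mk_eq, eq_comm,
      assoc_counit, hσ]
    simp [Arrow.mk_comp, D.mk_buh, Arrow.mk_id, Arrow.mk_eqToHom, Arrow.id_seq, Arrow.seq_id,
      Arrow.seq_left, Arrow.seq_right, Arrow.idA_left, D.tens_left, D.tens_right, D.buA, D.buL, hco]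
end

section
/- Let A be a right weak bimonoid in a duoidal category (M,∘,I,•,J). Then κ_{X,Y} is natural in both X and Y, and for all objects X, Y, Z of M the equality ζ.κ_{X,Y•Z} = (κ_{J,Y}•(X∘Z)).ζ holds as morphisms ((J∘A)•X)∘(A•Y•Z) → (J∘Y)•(X∘Z), where on the left ζ : X∘(Y•Z) → (J∘Y)•(X∘Z) and on the right ζ : ((J∘A)•X)∘(A•Y•Z) → (J∘A∘(A•Y))•(X∘Z). -/
open CategoryTheory

universe v u

namespace RWB

variable {M : Type u} [Category.{v} M] {D : Duo M} (W : RWB D)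

/-- The object `J∘A`. -/
def JA : M := D.co D.uJ W.A

/-- The morphism `κ_{X,Y} = (ϖ•(X∘Y)).((J∘(ε.μ))•(X∘Y)).ζ :
`((J∘A)•X)∘(A•Y) ⟶ X∘Y` of Lemma 1.4. -/
def kap (X Y : M) : D.co (D.bu W.JA X) (D.bu W.A Y) ⟶ D.co X Y :=
  D.zt W.JA X W.A Y
    ≫ D.buh (eqToHom (D.coA D.uJ W.A W.A) ≫ D.coh (𝟙 D.uJ) (W.mu ≫ W.ep))
        (𝟙 (D.co X Y))
    ≫ D.buh D.pw (𝟙 (D.co X Y))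
    ≫ eqToHom (D.buL (D.co X Y))

end RWB

namespace Duo

variable {M : Type u} [Category.{v} M] (D : Duo M)

/-- The interchange law is compatible with equalities of objects in its first two arguments. -/
theorem zt_eqToHom {A A' B B' : M} (hA : A = A') (hB : B = B') (C E : M) :
    D.zt A B C E = eqToHom (by rw [hA, hB]) ≫ D.zt A' B' C E ≫ eqToHom (by rw [hA, hB]) := by
  subst hA hB
  simp

theorem buh_eqToHom_comp_left {X X' Y Z Z' : M} (h : X = X') (f : X' ⟶ Y) (g : Z ⟶ Z') :
    D.buh (eqToHom h ≫ f) g = eqToHom (by rw [h]) ≫ D.buh f g := by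
  subst h
  simp

theorem buh_comp_eqToHom_left {X Y Y' Z Z' : M} (f : X ⟶ Y) (h : Y = Y') (g : Z ⟶ Z') :
    D.buh (f ≫ eqToHom h) g = D.buh f g ≫ eqToHom (by rw [h]) := by
  subst h
  simp

theorem buh_id_eqToHom {X Y Z Z' : M} (f : X ⟶ Y) (h : Z = Z') :
    D.buh f (𝟙 Z) = eqToHom (by rw [h]) ≫ D.buh f (𝟙 Z') ≫ eqToHom (by rw [h]) := by
  subst h
  simp

theorem buh_comp_id {X Y Z : M} (f : X ⟶ Y) (g : Y ⟶ Z) (W : M) :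
    D.buh (f ≫ g) (𝟙 W) = D.buh f (𝟙 W) ≫ D.buh g (𝟙 W) := by
  rw [← D.buh_comp, Category.comp_id]

/-- Bifunctoriality of `•` lets morphisms in the two arguments slide past each other. -/
theorem buh_exchange {X Y X' Y' : M} (f : X ⟶ Y) (g : X' ⟶ Y') :
    D.buh (𝟙 X) g ≫ D.buh f (𝟙 Y') = D.buh f (𝟙 X') ≫ D.buh (𝟙 Y) g := by
  rw [← D.buh_comp, ← D.buh_comp]
  simp

end Duo

namespace RWB

variable {M : Type u} [Category.{v} M] {D : Duo M} (W : RWB D)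

/-- The pairing `ϖ.(J∘(ε.μ)) : (J∘A)∘A ⟶ J` underlying `κ`. -/
def pairing : D.co W.JA W.A ⟶ D.uJ :=
  (eqToHom (show D.co W.JA W.A = _ from D.coA D.uJ W.A W.A) ≫ D.coh (𝟙 D.uJ) (W.mu ≫ W.ep))
    ≫ D.pw

theorem kap_eq (X Y : M) :
    W.kap X Y = D.zt W.JA X W.A Y ≫ D.buh W.pairing (𝟙 (D.co X Y))
      ≫ eqToHom (D.buL (D.co X Y)) := by
  rw [pairing, D.buh_comp_id, Category.assoc]
  rfl

theorem kap_natural {X X' Y Y' : M} (f : X ⟶ X') (g : Y ⟶ Y') :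
    D.coh (D.buh (𝟙 W.JA) f) (D.buh (𝟙 W.A) g) ≫ W.kap X' Y' = W.kap X Y ≫ D.coh f g := by
  rw [kap_eq, kap_eq, ← Category.assoc, D.zt_nat, D.coh_id, Category.assoc, ← Category.assoc
    (D.buh _ _), D.buh_exchange, D.buh_unitL]
  simp

/-- Compatibility of `κ` with the interchange law. -/
theorem kap_zt (X Y Z : M) :
    eqToHom (show D.co (D.bu W.JA X) (D.bu (D.bu W.A Y) Z)
          = D.co (D.bu W.JA X) (D.bu W.A (D.bu Y Z)) by simp [D.buA])
        ≫ W.kap X (D.bu Y Z)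
        ≫ eqToHom (show D.co X (D.bu Y Z) = D.co (D.bu D.uJ X) (D.bu Y Z) by
            simp [D.buL])
        ≫ D.zt D.uJ X Y Z
      = D.zt W.JA X (D.bu W.A Y) Z
        ≫ D.buh (eqToHom (show D.co W.JA (D.bu W.A Y)
              = D.co (D.bu W.JA D.uJ) (D.bu W.A Y) by simp [D.buR])
            ≫ W.kap D.uJ Y) (𝟙 (D.co X Z)) := by
  have assoc := congrArg
    (fun t => t ≫ D.buh (D.buh W.pairing (𝟙 (D.co D.uJ Y))) (𝟙 (D.co X Z))
      ≫ eqToHom (show _ = D.bu (D.co D.uJ Y) (D.co X Z) by rw [D.buL]))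
    (D.zt_assoc2 W.JA D.uJ X W.A Y Z)
  have slide : D.buh (𝟙 (D.co W.JA W.A)) (D.zt D.uJ X Y Z)
      ≫ D.buh W.pairing (𝟙 (D.bu (D.co D.uJ Y) (D.co X Z)))
      = D.buh W.pairing (𝟙 _) ≫ eqToHom (D.buL _) ≫ D.zt D.uJ X Y Z
        ≫ eqToHom (D.buL _).symm := by
    rw [D.buh_exchange, D.buh_unitL]
  simp only [Category.assoc, D.buh_assoc, D.buh_id, eqToHom_trans_assoc, eqToHom_refl,
    Category.id_comp, eqToHom_trans, reassoc_of% slide] at assoc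
  rw [kap_eq, kap_eq, D.zt_eqToHom (D.buR W.JA).symm rfl (D.bu W.A Y) Z,
    D.buh_eqToHom_comp_left, ← Category.assoc (D.zt W.JA D.uJ W.A Y),
    D.buh_comp_eqToHom_left, D.buh_comp_id,
    D.zt_eqToHom rfl (D.buL X).symm W.A (D.bu Y Z),
    D.buh_id_eqToHom W.pairing
      (show D.co X (D.bu Y Z) = D.co (D.bu D.uJ X) (D.bu Y Z) by rw [D.buL])]
  simp only [Category.assoc, D.buh_assoc, D.buh_id, eqToHom_trans_assoc, eqToHom_refl,
    Category.id_comp, eqToHom_trans]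
  rw [assoc]
  simp

end RWB

/-- For a right weak bimonoid `A` in a duoidal category, the morphism
`κ_{X,Y}` is natural in both `X` and `Y`, and for all objects `X, Y, Z` the equality
`ζ.κ_{X,Y•Z} = (κ_{J,Y}•(X∘Z)).ζ` holds (part (2) of Lemma 1.4). -/
theorem kappa_natural_and_compatible
    {M : Type u} [Category.{v} M] (D : Duo M) (W : RWB D) :
    (∀ {X X' Y Y' : M} (f : X ⟶ X') (g : Y ⟶ Y'),
      D.coh (D.buh (𝟙 W.JA) f) (D.buh (𝟙 W.A) g) ≫ W.kap X' Y'
        = W.kap X Y ≫ D.coh f g) ∧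
    (∀ X Y Z : M,
      eqToHom (show D.co (D.bu W.JA X) (D.bu (D.bu W.A Y) Z)
          = D.co (D.bu W.JA X) (D.bu W.A (D.bu Y Z)) by simp [D.buA])
        ≫ W.kap X (D.bu Y Z)
        ≫ eqToHom (show D.co X (D.bu Y Z) = D.co (D.bu D.uJ X) (D.bu Y Z) by
            simp [D.buL])
        ≫ D.zt D.uJ X Y Z
      = D.zt W.JA X (D.bu W.A Y) Z
        ≫ D.buh (eqToHom (show D.co W.JA (D.bu W.A Y)
              = D.co (D.bu W.JA D.uJ) (D.bu W.A Y) by simp [D.buR])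
            ≫ W.kap D.uJ Y) (𝟙 (D.co X Z))) := by
  exact ⟨fun f g => W.kap_natural f g, W.kap_zt⟩
end
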